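/- Let α>1 and 0<β<∞, let u be holomorphic on 𝔻 and φ a holomorphic self-map of 𝔻. Then uC_φ maps B^α boundedly into Z_β if and only if sup_{n≥0} (n+1)^α ‖(2u'φ' + uφ'')·φ^n‖_{ν_β} < ∞, sup_{n≥0} (n+1)^{α+1} ‖u·(φ')²·φ^n‖_{ν_β} < ∞, and sup_{n≥0} (n+1)^{α-1} ‖u''·φ^n‖_{ν_β} < ∞. -/

import Mathlib

open Complex Filter Set

noncomputable section

/-- The open unit disk in `ℂ`. -/
def unitDisk : Set ℂ := Metric.ball 0 1

/-- The weighted sup-norm `‖g‖_{ν_γ} = sup_{z ∈ 𝔻} (1-|z|²)^γ |g(z)|`. -/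
def wnorm (γ : ℝ) (g : ℂ → ℂ) : ℝ :=
  sSup ((fun z => (1 - ‖z‖ ^ 2) ^ γ * ‖g z‖) '' unitDisk)

/-- Membership in the weighted Banach space `H^∞_{ν_β}`. -/
def MemWeighted (β : ℝ) (g : ℂ → ℂ) : Prop :=
  DifferentiableOn ℂ g unitDisk ∧
    BddAbove ((fun z => (1 - ‖z‖ ^ 2) ^ β * ‖g z‖) '' unitDisk)

/-- Membership in the Bloch type space `B^α`. -/
def MemBloch (α : ℝ) (f : ℂ → ℂ) : Prop :=
  DifferentiableOn ℂ f unitDisk ∧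
    BddAbove ((fun z => (1 - ‖z‖ ^ 2) ^ α * ‖deriv f z‖) '' unitDisk)

/-- The Bloch type norm `‖f‖_{B^α} = |f(0)| + sup_{z∈𝔻}(1-|z|²)^α |f'(z)|`. -/
def blochNorm (α : ℝ) (f : ℂ → ℂ) : ℝ :=
  ‖f 0‖ + wnorm α (deriv f)

/-- Membership in the Zygmund type space `Z_β`. -/
def MemZygmund (β : ℝ) (f : ℂ → ℂ) : Prop :=
  DifferentiableOn ℂ f unitDisk ∧
    BddAbove ((fun z => (1 - ‖z‖ ^ 2) ^ β * ‖deriv (deriv f) z‖) '' unitDisk)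

/-- The Zygmund type norm `‖f‖_{Z_β} = |f(0)| + |f'(0)| + sup_{z∈𝔻}(1-|z|²)^β |f''(z)|`. -/
def zygNorm (β : ℝ) (f : ℂ → ℂ) : ℝ :=
  ‖f 0‖ + ‖deriv f 0‖ + wnorm β (deriv (deriv f))

/-- The weighted composition operator `uC_φ f = u · (f ∘ φ)`. -/
def wcomp (u φ f : ℂ → ℂ) : ℂ → ℂ := fun z => u z * f (φ z)

/-- `uC_φ` maps `B^α` boundedly into `Z_β`. -/
def BoundedBlochToZygmund (α β : ℝ) (u φ : ℂ → ℂ) : Prop :=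
  (∀ f, MemBloch α f → MemZygmund β (wcomp u φ f)) ∧
    ∃ C > 0, ∀ f, MemBloch α f → zygNorm β (wcomp u φ f) ≤ C * blochNorm α f

/-- `uC_φ` maps `B^α` boundedly into `H^∞_{ν_β}`. -/
def BoundedBlochToWeighted (α β : ℝ) (u φ : ℂ → ℂ) : Prop :=
  (∀ f, MemBloch α f → MemWeighted β (wcomp u φ f)) ∧
    ∃ C > 0, ∀ f, MemBloch α f → wnorm β (wcomp u φ f) ≤ C * blochNorm α f

/-- `uC_φ : B^α → Z_β` is compact: it is bounded and maps bounded sets of `B^α` to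
totally bounded (equivalently, since `Z_β` is complete, relatively compact) subsets
of `Z_β`. -/
def CompactBlochToZygmund (α β : ℝ) (u φ : ℂ → ℂ) : Prop :=
  BoundedBlochToZygmund α β u φ ∧
    ∀ r : ℝ, ∀ ε : ℝ, 0 < ε → ∃ T : Finset (ℂ → ℂ),
      (∀ g ∈ T, MemZygmund β g) ∧
      ∀ f, MemBloch α f → blochNorm α f ≤ r →
        ∃ g ∈ T, zygNorm β (fun z => wcomp u φ f z - g z) ≤ ε

/-- `uC_φ : B^α → H^∞_{ν_β}` is compact: it is bounded and maps bounded sets of `B^α`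
to totally bounded (equivalently, relatively compact) subsets of `H^∞_{ν_β}`. -/
def CompactBlochToWeighted (α β : ℝ) (u φ : ℂ → ℂ) : Prop :=
  BoundedBlochToWeighted α β u φ ∧
    ∀ r : ℝ, ∀ ε : ℝ, 0 < ε → ∃ T : Finset (ℂ → ℂ),
      (∀ g ∈ T, MemWeighted β g) ∧
      ∀ f, MemBloch α f → blochNorm α f ≤ r →
        ∃ g ∈ T, wnorm β (fun z => wcomp u φ f z - g z) ≤ ε

/-- A compact (linear, bounded, with totally bounded image of the unit ball) operator
from the subspace of `B^α` cut out by the predicate `P` into `Z_β`. -/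
def IsCompactOpToZygmund (α β : ℝ) (P : (ℂ → ℂ) → Prop) (K : (ℂ → ℂ) → ℂ → ℂ) : Prop :=
  (∀ f g, P f → P g → ∀ a b : ℂ,
      K (fun z => a * f z + b * g z) = fun z => a * K f z + b * K g z) ∧
  (∀ f, P f → MemZygmund β (K f)) ∧
  (∃ C, ∀ f, P f → zygNorm β (K f) ≤ C * blochNorm α f) ∧
  (∀ ε : ℝ, 0 < ε → ∃ T : Finset (ℂ → ℂ), (∀ g ∈ T, MemZygmund β g) ∧
      ∀ f, P f → blochNorm α f ≤ 1 → ∃ g ∈ T, zygNorm β (fun z => K f z - g z) ≤ ε)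

/-- The essential norm of `uC_φ`, as an operator from the subspace of `B^α` cut out by
the predicate `P` into `Z_β`: the distance to the compact operators, the operator norm
being the supremum over the unit ball. -/
def essNormZ (α β : ℝ) (P : (ℂ → ℂ) → Prop) (u φ : ℂ → ℂ) : ℝ :=
  sInf {r | ∃ K, IsCompactOpToZygmund α β P K ∧
    r = sSup {s | ∃ f, P f ∧ blochNorm α f ≤ 1 ∧
          s = zygNorm β (fun z => wcomp u φ f z - K f z)}}

/-- A compact (linear, bounded, with totally bounded image of the unit ball) operator
from `B^α` into `H^∞_{ν_β}`. -/
def IsCompactOpToWeighted (α β : ℝ) (K : (ℂ → ℂ) → ℂ → ℂ) : Prop :=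
  (∀ f g, MemBloch α f → MemBloch α g → ∀ a b : ℂ,
      K (fun z => a * f z + b * g z) = fun z => a * K f z + b * K g z) ∧
  (∀ f, MemBloch α f → MemWeighted β (K f)) ∧
  (∃ C, ∀ f, MemBloch α f → wnorm β (K f) ≤ C * blochNorm α f) ∧
  (∀ ε : ℝ, 0 < ε → ∃ T : Finset (ℂ → ℂ), (∀ g ∈ T, MemWeighted β g) ∧
      ∀ f, MemBloch α f → blochNorm α f ≤ 1 → ∃ g ∈ T, wnorm β (fun z => K f z - g z) ≤ ε)

/-- The essential norm of `uC_φ : B^α → H^∞_{ν_β}`. -/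
def essNormW (α β : ℝ) (u φ : ℂ → ℂ) : ℝ :=
  sInf {r | ∃ K, IsCompactOpToWeighted α β K ∧
    r = sSup {s | ∃ f, MemBloch α f ∧ blochNorm α f ≤ 1 ∧
          s = wnorm β (fun z => wcomp u φ f z - K f z)}}

/-- `limsup_{|φ(z)|→1} F(z) = lim_{s→1⁻} sup {F z : z ∈ 𝔻, |φ z| > s}`.  Since the inner
supremum is nonincreasing in `s`, the limit equals the infimum over `s ∈ [0,1)`; note
that `Real.sSup ∅ = 0`, matching the convention that the value is `0` when
`{z : |φ z| > s}` is empty for some `s < 1`. -/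
def phiLimsup (φ : ℂ → ℂ) (F : ℂ → ℝ) : ℝ :=
  sInf ((fun s => sSup {y | ∃ z ∈ unitDisk, s < ‖φ z‖ ∧ y = F z}) '' Set.Ico (0:ℝ) 1)

theorem mul_rpow_neg_le_of_pow_bound (γ C r X : ℝ) (hγ : 0 < γ) (hr1 : r < 1)
    (hX : 0 ≤ X) (h : ∀ n : ℕ, ((n : ℝ) + 1) ^ γ * (X * r ^ n) ≤ C) :
    X * (1 - r) ^ (-γ) ≤ C * (Real.exp 2 * 2 ^ γ) := by
  have h1r : 0 < 1 - r := by linarith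
  have hC : 0 ≤ C := by
    have := h 0
    simp at this
    linarith
  have he : 1 ≤ Real.exp 2 := Real.one_le_exp (by norm_num)
  have h2 : (1 : ℝ) ≤ 2 ^ γ := Real.one_le_rpow (by norm_num) hγ.le
  rcases lt_or_ge r (1 / 2) with hr | hr
  · have hX' : X ≤ C := by simpa using h 0
    have : (1 - r) ^ (-γ) ≤ 2 ^ γ := by
      rw [Real.rpow_neg h1r.le, ← Real.inv_rpow h1r.le]
      apply Real.rpow_le_rpow (by positivity) _ hγ.le
      rw [inv_le_comm₀ h1r (by norm_num)]
      linarith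
    calc X * (1 - r) ^ (-γ) ≤ C * 2 ^ γ := by gcongr
      _ ≤ C * (Real.exp 2 * 2 ^ γ) := by
        gcongr
        nlinarith
  · set n := ⌊1 / (1 - r)⌋₊ with hn
    have hn1 : 1 / (1 - r) ≤ (n : ℝ) + 1 := (Nat.lt_floor_add_one _).le
    have hn2 : (n : ℝ) ≤ 1 / (1 - r) := Nat.floor_le (by positivity)
    have hn3 : (n : ℝ) * (1 - r) ≤ 1 := by rwa [le_div_iff₀ h1r] at hn2
    have hrpos : 0 < r := by linarith
    have hlog : -(2 * (1 - r)) ≤ Real.log r := by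
      have h3 := Real.one_sub_inv_le_log_of_pos hrpos
      have h4 : r⁻¹ ≤ 1 + 2 * (1 - r) := by
        rw [inv_le_iff_one_le_mul₀ hrpos]
        nlinarith
      linarith
    have hpow : 1 ≤ r ^ n * Real.exp 2 := by
      have : r ^ n = Real.exp (n * Real.log r) := by
        rw [Real.exp_nat_mul, Real.exp_log hrpos]
      rw [this, ← Real.exp_add]
      apply Real.one_le_exp
      have : (n : ℝ) * (-(2 * (1 - r))) ≤ n * Real.log r := by gcongr
      nlinarith
    have hb : (1 - r) ^ (-γ) ≤ ((n : ℝ) + 1) ^ γ := by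
      rw [Real.rpow_neg h1r.le, ← Real.inv_rpow h1r.le]
      apply Real.rpow_le_rpow (by positivity) _ hγ.le
      rwa [← one_div]
    calc X * (1 - r) ^ (-γ) ≤ X * ((n : ℝ) + 1) ^ γ := by gcongr
      _ ≤ X * ((n : ℝ) + 1) ^ γ * (r ^ n * Real.exp 2) := le_mul_of_one_le_right (by positivity) hpow
      _ = ((n : ℝ) + 1) ^ γ * (X * r ^ n) * Real.exp 2 := by ring
      _ ≤ C * Real.exp 2 := by gcongr; exact h n
      _ ≤ C * (Real.exp 2 * 2 ^ γ) := by
        gcongr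
        nlinarith

theorem mem_unitDisk {z : ℂ} : z ∈ unitDisk ↔ ‖z‖ < 1 := by
  simp [unitDisk]

theorem isOpen_unitDisk : IsOpen unitDisk := Metric.isOpen_ball

theorem one_sub_norm_sq_pos {z : ℂ} (hz : z ∈ unitDisk) : 0 < 1 - ‖z‖ ^ 2 := by
  rw [mem_unitDisk] at hz
  nlinarith [norm_nonneg z]

theorem wnorm_nonneg (γ : ℝ) (g : ℂ → ℂ) : 0 ≤ wnorm γ g := by
  apply Real.sSup_nonneg
  rintro _ ⟨z, hz, rfl⟩
  have := one_sub_norm_sq_pos hz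
  positivity

theorem wnorm_le {γ : ℝ} {g : ℂ → ℂ} {C : ℝ}
    (h : ∀ z ∈ unitDisk, (1 - ‖z‖ ^ 2) ^ γ * ‖g z‖ ≤ C) : wnorm γ g ≤ C := by
  apply csSup_le (Set.Nonempty.image _ ⟨0, by simp [unitDisk]⟩)
  rintro _ ⟨z, hz, rfl⟩
  exact h z hz

theorem le_wnorm {γ : ℝ} {g : ℂ → ℂ}
    (h : BddAbove ((fun z => (1 - ‖z‖ ^ 2) ^ γ * ‖g z‖) '' unitDisk)) {z : ℂ}
    (hz : z ∈ unitDisk) : (1 - ‖z‖ ^ 2) ^ γ * ‖g z‖ ≤ wnorm γ g :=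
  le_csSup h ⟨z, hz, rfl⟩

theorem blochNorm_nonneg (α : ℝ) (f : ℂ → ℂ) : 0 ≤ blochNorm α f :=
  add_nonneg (norm_nonneg _) (wnorm_nonneg _ _)

theorem MemBloch.norm_deriv_le {α : ℝ} (hα : 0 < α) {f : ℂ → ℂ} (hf : MemBloch α f) {w : ℂ}
    (hw : w ∈ unitDisk) : ‖deriv f w‖ ≤ blochNorm α f * (1 - ‖w‖) ^ (-α) := by
  have h := le_wnorm hf.2 hw
  rw [mem_unitDisk] at hw
  have h1 : 0 < 1 - ‖w‖ := by linarith
  have h2 : (1 - ‖w‖) ^ α ≤ (1 - ‖w‖ ^ 2) ^ α := by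
    apply Real.rpow_le_rpow h1.le _ hα.le
    nlinarith [norm_nonneg w]
  have h3 : wnorm α (deriv f) ≤ blochNorm α f := le_add_of_nonneg_left (norm_nonneg _)
  rw [Real.rpow_neg h1.le, ← div_eq_mul_inv, le_div_iff₀ (by positivity), mul_comm]
  exact (mul_le_mul_of_nonneg_right h2 (norm_nonneg _)).trans (h.trans h3)

theorem MemBloch.norm_deriv_deriv_le {α : ℝ} (hα : 0 < α) {f : ℂ → ℂ} (hf : MemBloch α f)
    {w : ℂ} (hw : w ∈ unitDisk) :
    ‖deriv (deriv f) w‖ ≤ blochNorm α f * 2 ^ (α + 1) * (1 - ‖w‖) ^ (-(α + 1)) := by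
  have hw' := mem_unitDisk.1 hw
  have h1 : 0 < (1 - ‖w‖) / 2 := by linarith
  have hball : ∀ x ∈ Metric.closedBall w ((1 - ‖w‖) / 2), (1 - ‖w‖) / 2 ≤ 1 - ‖x‖ := by
    intro x hx
    have := norm_le_norm_add_norm_sub' x w
    rw [mem_closedBall_iff_norm] at hx
    linarith
  have hd : DifferentiableOn ℂ (deriv f) unitDisk := hf.1.deriv isOpen_unitDisk
  have key := Complex.norm_deriv_le_of_forall_mem_sphere_norm_le (c := w) (f := deriv f)
    (C := blochNorm α f * ((1 - ‖w‖) / 2) ^ (-α)) h1 ?_ ?_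
  · refine key.trans (le_of_eq ?_)
    rw [Real.rpow_neg h1.le, Real.rpow_neg (by linarith), Real.div_rpow (by linarith) (by norm_num),
      Real.rpow_add (sub_pos.2 hw'), Real.rpow_add (by norm_num), Real.rpow_one, Real.rpow_one]
    have : 0 < (1 - ‖w‖) := by linarith
    have : 0 < (1 - ‖w‖) ^ α := by positivity
    have : (0 : ℝ) < 2 ^ α := by positivity
    field_simp
  · apply DifferentiableOn.diffContOnCl
    apply hd.mono
    rw [closure_ball _ h1.ne']
    intro x hx
    have := hball x hx
    rw [mem_unitDisk]
    linarith
  · intro x hx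
    have hb := hball x (Metric.sphere_subset_closedBall hx)
    refine (hf.norm_deriv_le hα (mem_unitDisk.2 (by linarith))).trans ?_
    apply mul_le_mul_of_nonneg_left _ (blochNorm_nonneg _ _)
    exact Real.rpow_le_rpow_of_nonpos h1 hb (by linarith)

theorem MemBloch.norm_le {α : ℝ} (hα : 1 < α) {f : ℂ → ℂ} (hf : MemBloch α f)
    {w : ℂ} (hw : w ∈ unitDisk) :
    ‖f w‖ ≤ blochNorm α f * (1 + 1 / (α - 1)) * (1 - ‖w‖) ^ (-(α - 1)) := by
  have hw' := mem_unitDisk.1 hw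
  have h1 : 0 < 1 - ‖w‖ := by linarith
  have hα1 : 0 < α - 1 := by linarith
  set N := blochNorm α f
  have hN : 0 ≤ N := blochNorm_nonneg _ _
  have hpos : ∀ t ∈ Set.Icc (0 : ℝ) 1, 0 < 1 - t * ‖w‖ := by
    intro t ht
    nlinarith [norm_nonneg w, ht.1, ht.2, mul_le_mul_of_nonneg_right ht.2 (norm_nonneg w)]
  have hmem : ∀ t ∈ Set.Icc (0 : ℝ) 1, (t : ℂ) * w ∈ unitDisk := by
    intro t ht
    rw [mem_unitDisk, norm_mul, Complex.norm_real, Real.norm_of_nonneg ht.1]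
    linarith [hpos t ht]
  have hder : ∀ t ∈ Set.Icc (0 : ℝ) 1,
      HasDerivAt (fun t : ℝ => f ((t : ℂ) * w)) (deriv f ((t : ℂ) * w) * w) t := by
    intro t ht
    have hd : HasDerivAt f (deriv f ((t : ℂ) * w)) ((t : ℂ) * w) :=
      (hf.1.differentiableAt (isOpen_unitDisk.mem_nhds (hmem t ht))).hasDerivAt
    have h2 : HasDerivAt (fun s : ℂ => s * w) w (t : ℂ) := by
      simpa using (hasDerivAt_id (t : ℂ)).mul_const w
    exact (hd.comp (t : ℂ) h2).comp_ofReal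
  have hB : ∀ t ∈ Set.Icc (0 : ℝ) 1, HasDerivAt
      (fun t : ℝ => N + N / (α - 1) * (1 - t * ‖w‖) ^ (-(α - 1)))
      (N * (1 - t * ‖w‖) ^ (-α) * ‖w‖) t := by
    intro t ht
    have h2 : HasDerivAt (fun t : ℝ => 1 - t * ‖w‖) (-‖w‖) t := by
      simpa using ((hasDerivAt_id t).mul_const ‖w‖).const_sub 1
    have h3 := ((h2.rpow_const (p := -(α - 1)) (Or.inl (hpos t ht).ne')).const_mul
      (N / (α - 1))).const_add N
    rw [show -(α - 1) - 1 = -α by ring] at h3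
    refine h3.congr_deriv ?_
    field_simp
  have key := image_norm_le_of_norm_deriv_right_le_deriv_boundary' (a := (0 : ℝ)) (b := 1)
    (f := fun t : ℝ => f ((t : ℂ) * w)) (f' := fun t => deriv f ((t : ℂ) * w) * w)
    (B := fun t : ℝ => N + N / (α - 1) * (1 - t * ‖w‖) ^ (-(α - 1)))
    (B' := fun t => N * (1 - t * ‖w‖) ^ (-α) * ‖w‖)
    (fun t ht => (hder t ht).continuousAt.continuousWithinAt)
    (fun t ht => (hder t (Set.Ico_subset_Icc_self ht)).hasDerivWithinAt)
    (by
      have : ‖f 0‖ ≤ N := le_add_of_nonneg_right (wnorm_nonneg _ _)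
      have : 0 ≤ N / (α - 1) := by positivity
      simp
      linarith)
    (fun t ht => (hB t ht).continuousAt.continuousWithinAt)
    (fun t ht => (hB t (Set.Ico_subset_Icc_self ht)).hasDerivWithinAt)
    (by
      intro t ht
      have ht' := Set.Ico_subset_Icc_self ht
      have h2 := hf.norm_deriv_le (by linarith) (hmem t ht')
      rw [norm_mul _ w]
      rw [norm_mul, Complex.norm_real, Real.norm_of_nonneg ht.1] at h2
      gcongr)
    (x := 1) (by simp)
  simp only [Complex.ofReal_one, one_mul] at key
  have h5 : 1 ≤ (1 - ‖w‖) ^ (-(α - 1)) :=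
    Real.one_le_rpow_of_pos_of_le_one_of_nonpos h1 (by linarith [norm_nonneg w]) (by linarith)
  calc ‖f w‖ ≤ N + N / (α - 1) * (1 - ‖w‖) ^ (-(α - 1)) := key
    _ ≤ N * (1 - ‖w‖) ^ (-(α - 1)) + N / (α - 1) * (1 - ‖w‖) ^ (-(α - 1)) := by
      gcongr
      exact le_mul_of_one_le_right hN h5
    _ = _ := by ring

theorem hasDerivAt_wcomp {u φ f : ℂ → ℂ} (hu : DifferentiableOn ℂ u unitDisk)
    (hφd : DifferentiableOn ℂ φ unitDisk) (hφm : Set.MapsTo φ unitDisk unitDisk)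
    (hf : DifferentiableOn ℂ f unitDisk) {z : ℂ} (hz : z ∈ unitDisk) :
    HasDerivAt (wcomp u φ f) (deriv u z * f (φ z) + u z * (deriv f (φ z) * deriv φ z)) z := by
  have hu' := (hu.differentiableAt (isOpen_unitDisk.mem_nhds hz)).hasDerivAt
  have hφ' := (hφd.differentiableAt (isOpen_unitDisk.mem_nhds hz)).hasDerivAt
  have hf' := (hf.differentiableAt (isOpen_unitDisk.mem_nhds (hφm hz))).hasDerivAt
  exact hu'.mul (hf'.comp z hφ')

theorem deriv_deriv_wcomp {u φ f : ℂ → ℂ} (hu : DifferentiableOn ℂ u unitDisk)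
    (hφd : DifferentiableOn ℂ φ unitDisk) (hφm : Set.MapsTo φ unitDisk unitDisk)
    (hf : DifferentiableOn ℂ f unitDisk) {z : ℂ} (hz : z ∈ unitDisk) :
    deriv (deriv (wcomp u φ f)) z = deriv (deriv u) z * f (φ z) +
      (2 * deriv u z * deriv φ z + u z * deriv (deriv φ) z) * deriv f (φ z) +
      u z * deriv φ z ^ 2 * deriv (deriv f) (φ z) := by
  have hnhds := isOpen_unitDisk.mem_nhds hz
  have heq : deriv (wcomp u φ f) =ᶠ[nhds z] fun z => wcomp (deriv u) φ f z +
      wcomp (fun z => u z * deriv φ z) φ (deriv f) z := by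
    filter_upwards [hnhds] with x hx
    rw [(hasDerivAt_wcomp hu hφd hφm hf hx).deriv]
    simp only [wcomp]
    ring
  have hu1 := hu.deriv isOpen_unitDisk
  have hφ1 := hφd.deriv isOpen_unitDisk
  have hf1 := hf.deriv isOpen_unitDisk
  have hd : deriv (fun z => u z * deriv φ z) z =
      deriv u z * deriv φ z + u z * deriv (deriv φ) z :=
    ((hu.differentiableAt hnhds).hasDerivAt.mul (hφ1.differentiableAt hnhds).hasDerivAt).deriv
  have hsum : HasDerivAt (fun z => wcomp (deriv u) φ f z +
      wcomp (fun z => u z * deriv φ z) φ (deriv f) z) _ z :=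
    (hasDerivAt_wcomp hu1 hφd hφm hf hz).add
      (hasDerivAt_wcomp (u := fun z => u z * deriv φ z) (hu.mul hφ1) hφd hφm hf1 hz)
  rw [heq.deriv_eq, hsum.deriv, hd]
  ring

theorem natCast_rpow_mul_pow_le {α : ℝ} (hα : 0 < α) {r : ℝ} (hr0 : 0 ≤ r) (hr1 : r ≤ 1) (p : ℕ) :
    ((p : ℝ) + 1) ^ α * (r ^ p * (1 - r) ^ α) ≤ α ^ α * Real.exp 1 := by
  set x := ((p : ℝ) + 1) * (1 - r) with hx
  have h1r : 0 ≤ 1 - r := by linarith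
  have hx0 : 0 ≤ x := by positivity
  have h1 : x ^ α ≤ α ^ α * Real.exp x := by
    have h2 : x ≤ α * Real.exp (x / α) := by
      have := Real.add_one_le_exp (x / α)
      calc x = α * (x / α) := by field_simp
        _ ≤ _ := by gcongr; linarith
    calc x ^ α ≤ (α * Real.exp (x / α)) ^ α := Real.rpow_le_rpow hx0 h2 hα.le
      _ = α ^ α * Real.exp x := by
        rw [Real.mul_rpow hα.le (Real.exp_pos _).le, ← Real.exp_mul, div_mul_cancel₀ _ hα.ne']
  have h3 : r ^ p ≤ Real.exp (-(p * (1 - r))) := by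
    have : r ≤ Real.exp (-(1 - r)) := by
      have := Real.add_one_le_exp (-(1 - r))
      linarith
    calc r ^ p ≤ Real.exp (-(1 - r)) ^ p := by gcongr
      _ = _ := by rw [← Real.exp_nat_mul]; congr 1; ring
  calc ((p : ℝ) + 1) ^ α * (r ^ p * (1 - r) ^ α) = r ^ p * x ^ α := by
        rw [hx, Real.mul_rpow (by positivity) h1r]; ring
    _ ≤ Real.exp (-(p * (1 - r))) * (α ^ α * Real.exp x) := by gcongr
    _ = α ^ α * Real.exp (1 - r) := by
        rw [mul_left_comm, ← Real.exp_add]; congr 2; rw [hx]; ring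
    _ ≤ _ := by gcongr; linarith

theorem weight_mul_norm_deriv_pow_le {α : ℝ} (hα : 0 < α) (p : ℕ) {z : ℂ} (hz : z ∈ unitDisk) :
    (1 - ‖z‖ ^ 2) ^ α * ‖deriv (fun w : ℂ => w ^ (p + 1)) z‖ ≤
      2 ^ α * (α ^ α * Real.exp 1) * ((p : ℝ) + 1) ^ (-(α - 1)) := by
  have hz' := mem_unitDisk.1 hz
  have h1 : 0 < 1 - ‖z‖ := by linarith
  have hn := norm_nonneg z
  have h2 : (1 - ‖z‖ ^ 2) ^ α ≤ 2 ^ α * (1 - ‖z‖) ^ α := by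
    rw [← Real.mul_rpow (by norm_num) h1.le]
    apply Real.rpow_le_rpow (one_sub_norm_sq_pos hz).le _ hα.le
    nlinarith
  have hp : (0 : ℝ) < (p : ℝ) + 1 := by positivity
  have h3 := natCast_rpow_mul_pow_le hα hn hz'.le p
  have hd : ‖deriv (fun w : ℂ => w ^ (p + 1)) z‖ = ((p : ℝ) + 1) * ‖z‖ ^ p := by
    simp only [deriv_pow_field, norm_mul, norm_pow, Nat.add_sub_cancel]
    congr 1
    rw [Complex.norm_natCast]
    push_cast
    rfl
  have h4 : (p : ℝ) + 1 = ((p : ℝ) + 1) ^ α * ((p : ℝ) + 1) ^ (-(α - 1)) := by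
    rw [← Real.rpow_add hp]
    simp
  rw [hd]
  calc (1 - ‖z‖ ^ 2) ^ α * (((p : ℝ) + 1) * ‖z‖ ^ p)
      ≤ (2 ^ α * (1 - ‖z‖) ^ α) * (((p : ℝ) + 1) * ‖z‖ ^ p) := by gcongr
    _ = (2 ^ α * (1 - ‖z‖) ^ α) * ((((p : ℝ) + 1) ^ α * ((p : ℝ) + 1) ^ (-(α - 1))) * ‖z‖ ^ p) := by
      rw [← h4]
    _ = 2 ^ α * (((p : ℝ) + 1) ^ α * (‖z‖ ^ p * (1 - ‖z‖) ^ α)) * ((p : ℝ) + 1) ^ (-(α - 1)) := by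
      ring
    _ ≤ _ := by gcongr

theorem memBloch_pow {α : ℝ} (hα : 0 < α) (p : ℕ) : MemBloch α (fun w : ℂ => w ^ (p + 1)) := by
  refine ⟨by fun_prop, 2 ^ α * (α ^ α * Real.exp 1) * ((p : ℝ) + 1) ^ (-(α - 1)), ?_⟩
  rintro _ ⟨z, hz, rfl⟩
  exact weight_mul_norm_deriv_pow_le hα p hz

theorem blochNorm_pow_le {α : ℝ} (hα : 0 < α) (p : ℕ) :
    blochNorm α (fun w : ℂ => w ^ (p + 1)) ≤
      2 ^ α * (α ^ α * Real.exp 1) * ((p : ℝ) + 1) ^ (-(α - 1)) := by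
  have := wnorm_le fun z hz => weight_mul_norm_deriv_pow_le hα p hz
  simpa [blochNorm] using this

theorem memBloch_one (α : ℝ) : MemBloch α (fun _ : ℂ => 1) := by
  refine ⟨by fun_prop, 0, ?_⟩
  rintro _ ⟨z, hz, rfl⟩
  simp

theorem blochNorm_one_le (α : ℝ) : blochNorm α (fun _ : ℂ => 1) ≤ 1 := by
  have : wnorm α (deriv fun _ : ℂ => (1 : ℂ)) ≤ 0 := wnorm_le (by simp)
  simpa [blochNorm] using this

theorem norm_second_coeff_le_of_monomial_bounds {α K : ℝ} (hα : 1 < α) {A B D w : ℂ}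
    (hw : ‖w‖ ≤ 1) (hA : ‖A‖ ≤ K)
    (hE : ∀ m : ℕ, 1 ≤ m → (m : ℝ) ^ (α - 1) *
      ‖A * w ^ m + B * (m * w ^ (m - 1)) +
        D * (m * ((m - 1 : ℕ) * w ^ (m - 1 - 1)))‖ ≤ K) (n : ℕ) :
    ((n : ℝ) + 1) ^ (α + 1) * (‖D‖ * ‖w‖ ^ n) ≤ 4 ^ (α + 1) * (3 * K) := by
  have hK : 0 ≤ K := (norm_nonneg _).trans hA
  have hα1 : 0 < α - 1 := by linarith
  have h4 : (1 : ℝ) ≤ 4 ^ (α + 1) := Real.one_le_rpow (by norm_num) (by linarith)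
  have hw0 := norm_nonneg w
  rcases Nat.eq_zero_or_pos n with rfl | hn
  · have hE1 := hE 1 le_rfl
    have hE2 := hE 2 (by norm_num)
    simp only [Nat.cast_one, Real.one_rpow, one_mul, pow_one, Nat.sub_self, pow_zero, mul_one,
      Nat.cast_zero, zero_mul, mul_zero, add_zero] at hE1
    norm_num at hE2
    have h2 : (1 : ℝ) ≤ 2 ^ (α - 1) := Real.one_le_rpow (by norm_num) hα1.le
    have hE2' : ‖A * w ^ 2 + B * (2 * w) + D * 2‖ ≤ K :=
      (le_mul_of_one_le_left (norm_nonneg _) h2).trans hE2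
    have hD : D * 2 = (A * w ^ 2 + B * (2 * w) + D * 2) - 2 * w * (A * w + B) + A * w ^ 2 := by ring
    have hD2 : ‖D * 2‖ ≤ K + 2 * K + K := by
      rw [hD]
      refine (norm_add_le _ _).trans (add_le_add ((norm_sub_le _ _).trans (add_le_add hE2' ?_)) ?_)
      · rw [norm_mul, norm_mul, Complex.norm_ofNat]
        have := mul_le_mul hw hE1 (norm_nonneg _) zero_le_one
        linarith
      · rw [norm_mul, norm_pow]
        exact (mul_le_of_le_one_right (norm_nonneg _) (pow_le_one₀ hw0 hw)).trans hA
    rw [norm_mul, Complex.norm_ofNat] at hD2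
    simp
    nlinarith
  · obtain ⟨p, hp1, hp2⟩ : ∃ p : ℕ, 3 * p + 1 ≤ n ∧ n + 1 ≤ 4 * (p + 1) :=
      ⟨(n - 1) / 3, by omega, by omega⟩
    have hm0 : (0 : ℝ) < (p : ℝ) + 1 := by positivity
    have hbd : ∀ k : ℕ, 1 ≤ k → ((p : ℝ) + 1) ^ (α - 1) *
        ‖A * w ^ (k * (p + 1)) + B * ((k * (p + 1) : ℕ) * w ^ (k * (p + 1) - 1)) +
        D * ((k * (p + 1) : ℕ) * ((k * (p + 1) - 1 : ℕ) * w ^ (k * (p + 1) - 1 - 1)))‖ ≤ K := by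
      intro k hk
      refine le_trans ?_ (hE (k * (p + 1)) (Nat.mul_pos hk (Nat.succ_pos _)))
      have : (p : ℝ) + 1 ≤ (k * (p + 1) : ℕ) := by
        have : p + 1 ≤ k * (p + 1) := Nat.le_mul_of_pos_left _ hk
        exact_mod_cast this
      gcongr
    have h1 := hbd 1 le_rfl
    have h2 := hbd 2 (by norm_num)
    have h3 := hbd 3 (by norm_num)
    set E1 := A * w ^ (1 * (p + 1)) + B * ((1 * (p + 1) : ℕ) * w ^ (1 * (p + 1) - 1)) +
        D * ((1 * (p + 1) : ℕ) * ((1 * (p + 1) - 1 : ℕ) * w ^ (1 * (p + 1) - 1 - 1))) with hE1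
    set E2 := A * w ^ (2 * (p + 1)) + B * ((2 * (p + 1) : ℕ) * w ^ (2 * (p + 1) - 1)) +
        D * ((2 * (p + 1) : ℕ) * ((2 * (p + 1) - 1 : ℕ) * w ^ (2 * (p + 1) - 1 - 1))) with hE2
    set E3 := A * w ^ (3 * (p + 1)) + B * ((3 * (p + 1) : ℕ) * w ^ (3 * (p + 1) - 1)) +
        D * ((3 * (p + 1) : ℕ) * ((3 * (p + 1) - 1 : ℕ) * w ^ (3 * (p + 1) - 1 - 1))) with hE3
    have hid : 2 * (((p : ℂ) + 1) ^ 2 * (D * w ^ (3 * p + 1))) =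
        E3 - 2 * w ^ (p + 1) * E2 + w ^ (2 * (p + 1)) * E1 := by
      rw [hE1, hE2, hE3]
      simp only [show 3 * (p + 1) - 1 = 3 * p + 2 by omega,
        show 3 * p + 2 - 1 = 3 * p + 1 by omega, show 2 * (p + 1) - 1 = 2 * p + 1 by omega,
        show 2 * p + 1 - 1 = 2 * p by omega, show 1 * (p + 1) - 1 = p by omega]
      push_cast
      rcases p with _ | q
      · simp
        ring
      · simp only [Nat.add_sub_cancel]
        push_cast
        ring
    have hw1 : ∀ j : ℕ, ‖w ^ j‖ ≤ 1 := fun j => by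
      rw [norm_pow]
      exact pow_le_one₀ hw0 hw
    have hnorm : 2 * (((p : ℝ) + 1) ^ 2 * (‖D‖ * ‖w‖ ^ (3 * p + 1))) ≤ ‖E3‖ + 2 * ‖E2‖ + ‖E1‖ := by
      have hpn : ‖(p : ℂ) + 1‖ = (p : ℝ) + 1 := by
        exact_mod_cast Complex.norm_natCast (p + 1)
      have := congrArg norm hid
      rw [norm_mul, norm_mul, norm_pow, hpn, norm_mul, norm_pow, Complex.norm_ofNat] at this
      rw [this]
      refine (norm_add_le _ _).trans (add_le_add ((norm_sub_le _ _).trans (add_le_add le_rfl ?_)) ?_)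
      · rw [norm_mul, norm_mul, Complex.norm_ofNat]
        have := mul_le_mul_of_nonneg_right (hw1 (p + 1)) (norm_nonneg E2)
        linarith
      · rw [norm_mul]
        exact mul_le_of_le_one_left (norm_nonneg _) (hw1 _)
    have hmain : ((p : ℝ) + 1) ^ (α + 1) * (‖D‖ * ‖w‖ ^ (3 * p + 1)) ≤ 2 * K := by
      have hsplit : ((p : ℝ) + 1) ^ (α + 1) = ((p : ℝ) + 1) ^ (α - 1) * ((p : ℝ) + 1) ^ 2 := by
        rw [← Real.rpow_natCast, ← Real.rpow_add hm0]
        norm_num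
        ring_nf
      have := mul_le_mul_of_nonneg_left hnorm (Real.rpow_nonneg hm0.le (α - 1))
      rw [hsplit]
      nlinarith
    have hn1 : ((n : ℝ) + 1) ^ (α + 1) ≤ 4 ^ (α + 1) * ((p : ℝ) + 1) ^ (α + 1) := by
      rw [← Real.mul_rpow (by norm_num) hm0.le]
      apply Real.rpow_le_rpow (by positivity) _ (by linarith)
      exact_mod_cast hp2
    calc ((n : ℝ) + 1) ^ (α + 1) * (‖D‖ * ‖w‖ ^ n)
        ≤ (4 ^ (α + 1) * ((p : ℝ) + 1) ^ (α + 1)) * (‖D‖ * ‖w‖ ^ (3 * p + 1)) := by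
          have := pow_le_pow_of_le_one hw0 hw hp1
          gcongr
      _ = 4 ^ (α + 1) * (((p : ℝ) + 1) ^ (α + 1) * (‖D‖ * ‖w‖ ^ (3 * p + 1))) := by ring
      _ ≤ 4 ^ (α + 1) * (3 * K) :=
          mul_le_mul_of_nonneg_left (by linarith) (by positivity)

theorem norm_first_coeff_le_of_monomial_bounds {α K L : ℝ} (hα : 1 < α) {A B D w : ℂ}
    (hw : ‖w‖ ≤ 1) (hA : ‖A‖ ≤ K)
    (hE : ∀ m : ℕ, 1 ≤ m → (m : ℝ) ^ (α - 1) *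
      ‖A * w ^ m + B * (m * w ^ (m - 1)) +
        D * (m * ((m - 1 : ℕ) * w ^ (m - 1 - 1)))‖ ≤ K)
    (hD : ∀ n : ℕ, ((n : ℝ) + 1) ^ (α + 1) * (‖D‖ * ‖w‖ ^ n) ≤ L) (n : ℕ) :
    ((n : ℝ) + 1) ^ α * (‖B‖ * ‖w‖ ^ n) ≤ 3 ^ α * (2 * K + 3 * L) := by
  have hK : 0 ≤ K := (norm_nonneg _).trans hA
  have hL : 0 ≤ L := le_trans (by positivity) (hD 0)
  have hα1 : 0 < α - 1 := by linarith
  have h3α : (1 : ℝ) ≤ 3 ^ α := Real.one_le_rpow (by norm_num) (by linarith)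
  have hw0 := norm_nonneg w
  rcases Nat.eq_zero_or_pos n with rfl | hn
  · have hE1 := hE 1 le_rfl
    simp only [Nat.cast_one, Real.one_rpow, one_mul, pow_one, Nat.sub_self, pow_zero, mul_one,
      Nat.cast_zero, zero_mul, mul_zero, add_zero] at hE1
    have hB : ‖B‖ ≤ K + K := by
      rw [show B = (A * w + B) - A * w by ring]
      refine (norm_sub_le _ _).trans (add_le_add hE1 ?_)
      rw [norm_mul]
      exact (mul_le_of_le_one_right (norm_nonneg _) hw).trans hA
    simp
    nlinarith
  · obtain ⟨p, hp1, hp2⟩ : ∃ p : ℕ, 2 * p + 1 ≤ n ∧ n + 1 ≤ 3 * (p + 1) :=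
      ⟨(n - 1) / 2, by omega, by omega⟩
    have hm0 : (0 : ℝ) < (p : ℝ) + 1 := by positivity
    have h1 := hE (p + 1) (by omega)
    have h2 : ((p : ℝ) + 1) ^ (α - 1) * _ ≤ K := le_trans (by
        have : (p : ℝ) + 1 ≤ (2 * (p + 1) : ℕ) := by
          exact_mod_cast (by omega : p + 1 ≤ 2 * (p + 1))
        gcongr) (hE (2 * (p + 1)) (by omega))
    rw [show ((p + 1 : ℕ) : ℝ) = (p : ℝ) + 1 by push_cast; rfl] at h1
    set E1 := A * w ^ (p + 1) + B * ((p + 1 : ℕ) * w ^ (p + 1 - 1)) +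
        D * ((p + 1 : ℕ) * ((p + 1 - 1 : ℕ) * w ^ (p + 1 - 1 - 1))) with hE1
    set E2 := A * w ^ (2 * (p + 1)) + B * ((2 * (p + 1) : ℕ) * w ^ (2 * (p + 1) - 1)) +
        D * ((2 * (p + 1) : ℕ) * ((2 * (p + 1) - 1 : ℕ) * w ^ (2 * (p + 1) - 1 - 1))) with hE2
    have hid : ((p : ℂ) + 1) * (B * w ^ (2 * p + 1)) =
        E2 - w ^ (p + 1) * E1 - (p + 1) * (3 * p + 2) * (D * w ^ (2 * p)) := by
      rw [hE1, hE2]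
      simp only [show 2 * (p + 1) - 1 = 2 * p + 1 by omega,
        show 2 * p + 1 - 1 = 2 * p by omega, show p + 1 - 1 = p by omega]
      push_cast
      rcases p with _ | q
      · simp
        ring
      · simp only [Nat.add_sub_cancel]
        push_cast
        ring
    have hnorm : ((p : ℝ) + 1) * (‖B‖ * ‖w‖ ^ (2 * p + 1)) ≤ ‖E2‖ + ‖E1‖ +
        ((p : ℝ) + 1) * (3 * p + 2) * (‖D‖ * ‖w‖ ^ (2 * p)) := by
      have hpn : ‖(p : ℂ) + 1‖ = (p : ℝ) + 1 := by
        exact_mod_cast Complex.norm_natCast (p + 1)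
      have hpn3 : ‖3 * (p : ℂ) + 2‖ = 3 * (p : ℝ) + 2 := by
        exact_mod_cast Complex.norm_natCast (3 * p + 2)
      have := congrArg norm hid
      rw [norm_mul, norm_mul, norm_pow, hpn] at this
      rw [this]
      refine (norm_sub_le _ _).trans (add_le_add ((norm_sub_le _ _).trans (add_le_add le_rfl ?_)) ?_)
      · rw [norm_mul, norm_pow]
        exact mul_le_of_le_one_left (norm_nonneg _) (pow_le_one₀ hw0 hw)
      · rw [norm_mul, norm_mul, norm_mul, norm_pow, hpn, hpn3]
    have hD' : ((p : ℝ) + 1) ^ (α - 1) * (((p : ℝ) + 1) * (3 * p + 2) * (‖D‖ * ‖w‖ ^ (2 * p))) ≤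
        3 * L := by
      have hsplit : ((p : ℝ) + 1) ^ (α + 1) = ((p : ℝ) + 1) ^ (α - 1) * ((p : ℝ) + 1) ^ 2 := by
        rw [← Real.rpow_natCast, ← Real.rpow_add hm0]
        norm_num
        ring_nf
      have hd := hD (2 * p)
      have : ((p : ℝ) + 1) ^ (α + 1) ≤ ((2 * p : ℕ) + 1 : ℝ) ^ (α + 1) := by
        apply Real.rpow_le_rpow hm0.le _ (by linarith)
        push_cast
        linarith [(Nat.cast_nonneg p : (0 : ℝ) ≤ p)]
      calc ((p : ℝ) + 1) ^ (α - 1) * (((p : ℝ) + 1) * (3 * p + 2) * (‖D‖ * ‖w‖ ^ (2 * p)))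
          ≤ ((p : ℝ) + 1) ^ (α - 1) * (((p : ℝ) + 1) * (3 * (p + 1)) * (‖D‖ * ‖w‖ ^ (2 * p))) := by
            gcongr
            linarith
        _ = 3 * (((p : ℝ) + 1) ^ (α + 1) * (‖D‖ * ‖w‖ ^ (2 * p))) := by rw [hsplit]; ring
        _ ≤ 3 * (((2 * p : ℕ) + 1 : ℝ) ^ (α + 1) * (‖D‖ * ‖w‖ ^ (2 * p))) := by gcongr
        _ ≤ 3 * L := by gcongr
    have hmain : ((p : ℝ) + 1) ^ α * (‖B‖ * ‖w‖ ^ (2 * p + 1)) ≤ 2 * K + 3 * L := by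
      have hsplit : ((p : ℝ) + 1) ^ α = ((p : ℝ) + 1) ^ (α - 1) * ((p : ℝ) + 1) := by
        rw [← Real.rpow_add_one hm0.ne']
        norm_num
      have := mul_le_mul_of_nonneg_left hnorm (Real.rpow_nonneg hm0.le (α - 1))
      rw [hsplit]
      linarith
    have hn1 : ((n : ℝ) + 1) ^ α ≤ 3 ^ α * ((p : ℝ) + 1) ^ α := by
      rw [← Real.mul_rpow (by norm_num) hm0.le]
      apply Real.rpow_le_rpow (by positivity) _ (by linarith)
      exact_mod_cast hp2
    calc ((n : ℝ) + 1) ^ α * (‖B‖ * ‖w‖ ^ n)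
        ≤ (3 ^ α * ((p : ℝ) + 1) ^ α) * (‖B‖ * ‖w‖ ^ (2 * p + 1)) := by
          have := pow_le_pow_of_le_one hw0 hw hp1
          gcongr
      _ = 3 ^ α * (((p : ℝ) + 1) ^ α * (‖B‖ * ‖w‖ ^ (2 * p + 1))) := by ring
      _ ≤ 3 ^ α * (2 * K + 3 * L) := by gcongr

theorem norm_zeroth_coeff_le_of_monomial_bounds {α K L M : ℝ} (hα : 1 < α) {A B D w : ℂ}
    (hw : ‖w‖ ≤ 1) (hA : ‖A‖ ≤ K)
    (hE : ∀ m : ℕ, 1 ≤ m → (m : ℝ) ^ (α - 1) *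
      ‖A * w ^ m + B * (m * w ^ (m - 1)) +
        D * (m * ((m - 1 : ℕ) * w ^ (m - 1 - 1)))‖ ≤ K)
    (hD : ∀ n : ℕ, ((n : ℝ) + 1) ^ (α + 1) * (‖D‖ * ‖w‖ ^ n) ≤ L)
    (hB : ∀ n : ℕ, ((n : ℝ) + 1) ^ α * (‖B‖ * ‖w‖ ^ n) ≤ M) (n : ℕ) :
    ((n : ℝ) + 1) ^ (α - 1) * (‖A‖ * ‖w‖ ^ n) ≤ 2 ^ (α - 1) * (K + M + 2 ^ α * L) := by
  have hK : 0 ≤ K := (norm_nonneg _).trans hA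
  have hL : 0 ≤ L := le_trans (by positivity) (hD 0)
  have hM : 0 ≤ M := le_trans (by positivity) (hB 0)
  have hα1 : 0 < α - 1 := by linarith
  have h2α : (0 : ℝ) ≤ 2 ^ α * L := by positivity
  have hw0 := norm_nonneg w
  have hsmall : ‖A‖ * ‖w‖ ^ n ≤ K :=
    (mul_le_of_le_one_right (norm_nonneg _) (pow_le_one₀ hw0 hw)).trans hA
  rcases Nat.lt_or_ge n 2 with hn | hn
  · have : ((n : ℝ) + 1) ^ (α - 1) ≤ 2 ^ (α - 1) := by
      apply Real.rpow_le_rpow (by positivity) _ hα1.le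
      exact_mod_cast hn
    calc _ ≤ 2 ^ (α - 1) * K := by gcongr
      _ ≤ _ := by gcongr; linarith
  · obtain ⟨k, rfl⟩ := Nat.exists_eq_add_of_le' hn
    have hE' := hE (k + 2) (by omega)
    have hB' := hB (k + 1)
    have hD' := hD k
    have hk1 : (0 : ℝ) < (k : ℝ) + 1 := by positivity
    have hk2 : (0 : ℝ) < (k : ℝ) + 2 := by positivity
    simp only [show k + 2 - 1 = k + 1 by omega, Nat.add_sub_cancel] at hE'
    set E := A * w ^ (k + 2) + B * ((k + 2 : ℕ) * w ^ (k + 1)) +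
      D * ((k + 2 : ℕ) * ((k + 1 : ℕ) * w ^ k)) with hEdef
    have hnorm : ‖A‖ * ‖w‖ ^ (k + 2) ≤ ‖E‖ + ((k : ℝ) + 2) * (‖B‖ * ‖w‖ ^ (k + 1)) +
        ((k : ℝ) + 2) * ((k : ℝ) + 1) * (‖D‖ * ‖w‖ ^ k) := by
      have hid : A * w ^ (k + 2) = E - B * ((k + 2 : ℕ) * w ^ (k + 1)) -
        D * ((k + 2 : ℕ) * ((k + 1 : ℕ) * w ^ k)) := by rw [hEdef]; ring
      have h := congrArg norm hid
      rw [norm_mul, norm_pow] at h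
      rw [h]
      refine (norm_sub_le _ _).trans (add_le_add ((norm_sub_le _ _).trans (add_le_add le_rfl ?_)) ?_)
      · rw [norm_mul, norm_mul, norm_pow, Complex.norm_natCast]
        push_cast
        exact le_of_eq (by ring)
      · rw [norm_mul, norm_mul, norm_mul, norm_pow, Complex.norm_natCast, Complex.norm_natCast]
        push_cast
        exact le_of_eq (by ring)
    push_cast at hE' hB'
    rw [show (k : ℝ) + 1 + 1 = k + 2 by ring] at hB'
    have hBs : ((k : ℝ) + 2) ^ (α - 1) * (((k : ℝ) + 2) * (‖B‖ * ‖w‖ ^ (k + 1))) ≤ M := by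
      rw [← mul_assoc, ← Real.rpow_add_one hk2.ne', sub_add_cancel]
      exact hB'
    have hDs : ((k : ℝ) + 2) ^ (α - 1) * (((k : ℝ) + 2) * ((k : ℝ) + 1) * (‖D‖ * ‖w‖ ^ k)) ≤
        2 ^ α * L := by
      have h1 : ((k : ℝ) + 2) ^ (α - 1) * (((k : ℝ) + 2) * ((k : ℝ) + 1) * (‖D‖ * ‖w‖ ^ k)) =
          ((k : ℝ) + 2) ^ α * (((k : ℝ) + 1) * (‖D‖ * ‖w‖ ^ k)) := by
        rw [show α = (α - 1) + 1 by ring, Real.rpow_add_one hk2.ne']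
        simp only [add_sub_cancel_right]
        ring
      have h2 : ((k : ℝ) + 2) ^ α ≤ 2 ^ α * ((k : ℝ) + 1) ^ α := by
        rw [← Real.mul_rpow (by norm_num) hk1.le]
        apply Real.rpow_le_rpow hk2.le _ (by linarith)
        linarith [(Nat.cast_nonneg k : (0 : ℝ) ≤ k)]
      rw [h1]
      calc ((k : ℝ) + 2) ^ α * (((k : ℝ) + 1) * (‖D‖ * ‖w‖ ^ k))
          ≤ (2 ^ α * ((k : ℝ) + 1) ^ α) * (((k : ℝ) + 1) * (‖D‖ * ‖w‖ ^ k)) := by gcongr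
        _ = 2 ^ α * (((k : ℝ) + 1) ^ (α + 1) * (‖D‖ * ‖w‖ ^ k)) := by
          rw [Real.rpow_add_one hk1.ne']; ring
        _ ≤ 2 ^ α * L := by gcongr
    have hmain : ((k : ℝ) + 2) ^ (α - 1) * (‖A‖ * ‖w‖ ^ (k + 2)) ≤ K + M + 2 ^ α * L := by
      have := mul_le_mul_of_nonneg_left hnorm (Real.rpow_nonneg hk2.le (α - 1))
      linarith
    have hn1 : (((k + 2 : ℕ) : ℝ) + 1) ^ (α - 1) ≤ 2 ^ (α - 1) * ((k : ℝ) + 2) ^ (α - 1) := by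
      rw [← Real.mul_rpow (by norm_num) hk2.le]
      apply Real.rpow_le_rpow (by positivity) _ hα1.le
      push_cast
      linarith [(Nat.cast_nonneg k : (0 : ℝ) ≤ k)]
    calc _ ≤ (2 ^ (α - 1) * ((k : ℝ) + 2) ^ (α - 1)) * (‖A‖ * ‖w‖ ^ (k + 2)) := by gcongr
      _ = 2 ^ (α - 1) * (((k : ℝ) + 2) ^ (α - 1) * (‖A‖ * ‖w‖ ^ (k + 2))) := by ring
      _ ≤ _ := by gcongr

theorem BoundedBlochToZygmund.exists_weight_mul_le {α β : ℝ} {u φ : ℂ → ℂ}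
    (h : BoundedBlochToZygmund α β u φ) (hu : DifferentiableOn ℂ u unitDisk)
    (hφd : DifferentiableOn ℂ φ unitDisk) (hφm : Set.MapsTo φ unitDisk unitDisk) :
    ∃ C > 0, ∀ f, MemBloch α f → ∀ z ∈ unitDisk,
      (1 - ‖z‖ ^ 2) ^ β * ‖deriv (deriv u) z * f (φ z) +
      (2 * deriv u z * deriv φ z + u z * deriv (deriv φ) z) * deriv f (φ z) +
      u z * deriv φ z ^ 2 * deriv (deriv f) (φ z)‖ ≤ C * blochNorm α f := by
  obtain ⟨hmem, C, hC, hbd⟩ := h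
  refine ⟨C, hC, fun f hf z hz => ?_⟩
  rw [← deriv_deriv_wcomp hu hφd hφm hf.1 hz]
  refine (le_wnorm (hmem f hf).2 hz).trans (le_trans ?_ (hbd f hf))
  exact le_add_of_nonneg_left (add_nonneg (norm_nonneg _) (norm_nonneg _))

theorem BoundedBlochToZygmund.exists_monomial_bounds {α β : ℝ} (hα : 1 < α) {u φ : ℂ → ℂ}
    (h : BoundedBlochToZygmund α β u φ) (hu : DifferentiableOn ℂ u unitDisk)
    (hφd : DifferentiableOn ℂ φ unitDisk) (hφm : Set.MapsTo φ unitDisk unitDisk) :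
    ∃ K, ∀ z ∈ unitDisk,
      (1 - ‖z‖ ^ 2) ^ β * ‖deriv (deriv u) z‖ ≤ K ∧
      ∀ m : ℕ, 1 ≤ m → (m : ℝ) ^ (α - 1) * ((1 - ‖z‖ ^ 2) ^ β *
        ‖deriv (deriv u) z * φ z ^ m +
        (2 * deriv u z * deriv φ z + u z * deriv (deriv φ) z) * (m * φ z ^ (m - 1)) +
        u z * deriv φ z ^ 2 * (m * ((m - 1 : ℕ) * φ z ^ (m - 1 - 1)))‖) ≤ K := by
  obtain ⟨C, hC, hbd⟩ := h.exists_weight_mul_le hu hφd hφm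
  refine ⟨C * max 1 (2 ^ α * (α ^ α * Real.exp 1)), fun z hz => ⟨?_, fun m hm => ?_⟩⟩
  · have h1 := hbd _ (memBloch_one α) z hz
    have h2 := blochNorm_one_le α
    simp only [deriv_const', deriv_const, mul_zero, add_zero, mul_one] at h1
    refine h1.trans ?_
    gcongr
    exact h2.trans (le_max_left _ _)
  · obtain ⟨p, rfl⟩ := Nat.exists_eq_add_of_le' hm
    have hp : (0 : ℝ) < (p : ℝ) + 1 := by positivity
    have h1 := hbd _ (memBloch_pow (by linarith : 0 < α) p) z hz
    have h2 := blochNorm_pow_le (by linarith : 0 < α) p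
    have hd : deriv (fun w : ℂ => w ^ (p + 1)) = fun w => ((p + 1 : ℕ) : ℂ) * w ^ (p + 1 - 1) := by
      ext w
      simp
    have hd2 : deriv (deriv (fun w : ℂ => w ^ (p + 1))) (φ z) =
        ((p + 1 : ℕ) : ℂ) * ((p + 1 - 1 : ℕ) * φ z ^ (p + 1 - 1 - 1)) := by
      rw [hd, deriv_const_mul_field]
      simp
    rw [hd2, hd] at h1
    have h3 : ((p + 1 : ℕ) : ℝ) ^ (α - 1) * ((p : ℝ) + 1) ^ (-(α - 1)) = 1 := by
      push_cast
      rw [← Real.rpow_add hp]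
      simp
    calc _ ≤ ((p + 1 : ℕ) : ℝ) ^ (α - 1) *
          (C * (2 ^ α * (α ^ α * Real.exp 1) * ((p : ℝ) + 1) ^ (-(α - 1)))) := by
          exact mul_le_mul_of_nonneg_left (h1.trans (mul_le_mul_of_nonneg_left h2 hC.le))
            (by positivity)
      _ = C * (2 ^ α * (α ^ α * Real.exp 1)) *
          (((p + 1 : ℕ) : ℝ) ^ (α - 1) * ((p : ℝ) + 1) ^ (-(α - 1))) := by ring
      _ ≤ _ := by
          rw [h3, mul_one]
          gcongr
          exact le_max_right _ _

theorem exists_rpow_bound_of_pow_bound {β γ : ℝ} (hγ : 0 < γ) {φ g : ℂ → ℂ}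
    (hφm : Set.MapsTo φ unitDisk unitDisk)
    (h : ∃ C : ℝ, ∀ n : ℕ, ∀ z ∈ unitDisk,
      ((n : ℝ) + 1) ^ γ * ((1 - ‖z‖ ^ 2) ^ β * ‖g z * φ z ^ n‖) ≤ C) :
    ∃ C : ℝ, ∀ z ∈ unitDisk, (1 - ‖z‖ ^ 2) ^ β * ‖g z‖ * (1 - ‖φ z‖) ^ (-γ) ≤ C := by
  obtain ⟨C, hC⟩ := h
  refine ⟨C * (Real.exp 2 * 2 ^ γ), fun z hz => ?_⟩
  have := one_sub_norm_sq_pos hz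
  refine mul_rpow_neg_le_of_pow_bound γ C ‖φ z‖ _ hγ (mem_unitDisk.1 (hφm hz)) (by positivity)
    fun n => ?_
  have := hC n z hz
  rwa [norm_mul, norm_pow, ← mul_assoc (_ ^ β)] at this

/-- **Theorem 3.3** (sequential form). For `α > 1`, `uC_φ : B^α → Z_β` is bounded iff
`sup_n (n+1)^α ‖(2u'φ'+uφ'')φ^n‖_ν_β < ∞`, `sup_n (n+1)^(α+1) ‖u(φ')²φ^n‖_ν_β < ∞` and
`sup_n (n+1)^(α-1) ‖u''φ^n‖_ν_β < ∞`. -/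
theorem weighted_comp_bounded_Bloch_to_Zygmund_iff_of_one_lt
    (α β : ℝ) (hα : 1 < α) (hβ : 0 < β)
    (u φ : ℂ → ℂ) (hu : DifferentiableOn ℂ u unitDisk)
    (hφd : DifferentiableOn ℂ φ unitDisk) (hφm : Set.MapsTo φ unitDisk unitDisk) :
    BoundedBlochToZygmund α β u φ ↔
      (∃ C : ℝ, ∀ n : ℕ, ∀ z ∈ unitDisk,
        ((n : ℝ) + 1) ^ α *
          ((1 - ‖z‖ ^ 2) ^ β *
            ‖(2 * deriv u z * deriv φ z + u z * deriv (deriv φ) z) * φ z ^ n‖) ≤ C) ∧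
      (∃ C : ℝ, ∀ n : ℕ, ∀ z ∈ unitDisk,
        ((n : ℝ) + 1) ^ (α + 1) *
          ((1 - ‖z‖ ^ 2) ^ β * ‖u z * deriv φ z ^ 2 * φ z ^ n‖) ≤ C) ∧
      (∃ C : ℝ, ∀ n : ℕ, ∀ z ∈ unitDisk,
        ((n : ℝ) + 1) ^ (α - 1) *
          ((1 - ‖z‖ ^ 2) ^ β * ‖deriv (deriv u) z * φ z ^ n‖) ≤ C) := by
  constructor
  · intro h
    obtain ⟨K, hK⟩ := h.exists_monomial_bounds hα hu hφd hφm
    have key : ∀ z ∈ unitDisk, ∀ n : ℕ,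
        ((n : ℝ) + 1) ^ (α + 1) *
          ((1 - ‖z‖ ^ 2) ^ β * ‖u z * deriv φ z ^ 2 * φ z ^ n‖) ≤ 4 ^ (α + 1) * (3 * K) ∧
        ((n : ℝ) + 1) ^ α *
          ((1 - ‖z‖ ^ 2) ^ β *
            ‖(2 * deriv u z * deriv φ z + u z * deriv (deriv φ) z) * φ z ^ n‖) ≤
          3 ^ α * (2 * K + 3 * (4 ^ (α + 1) * (3 * K))) ∧
        ((n : ℝ) + 1) ^ (α - 1) *
          ((1 - ‖z‖ ^ 2) ^ β * ‖deriv (deriv u) z * φ z ^ n‖) ≤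
          2 ^ (α - 1) * (K + 3 ^ α * (2 * K + 3 * (4 ^ (α + 1) * (3 * K))) +
            2 ^ α * (4 ^ (α + 1) * (3 * K))) := by
      intro z hz n
      obtain ⟨h0, hm⟩ := hK z hz
      have hw := (mem_unitDisk.1 (hφm hz)).le
      set v : ℝ := (1 - ‖z‖ ^ 2) ^ β with hv
      have hv0 : 0 ≤ v := Real.rpow_nonneg (one_sub_norm_sq_pos hz).le _
      have hvn : ∀ x : ℂ, ‖(v : ℂ) * x‖ = v * ‖x‖ := fun x => by
        rw [norm_mul, Complex.norm_real, Real.norm_of_nonneg hv0]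
      have hA : ‖(v : ℂ) * deriv (deriv u) z‖ ≤ K := by rwa [hvn]
      have hE : ∀ m : ℕ, 1 ≤ m → (m : ℝ) ^ (α - 1) *
          ‖(v : ℂ) * deriv (deriv u) z * φ z ^ m +
          (v : ℂ) * (2 * deriv u z * deriv φ z + u z * deriv (deriv φ) z) *
            (m * φ z ^ (m - 1)) +
          (v : ℂ) * (u z * deriv φ z ^ 2) *
            (m * ((m - 1 : ℕ) * φ z ^ (m - 1 - 1)))‖ ≤ K := by
        intro m h1
        have := hm m h1
        rw [← hvn, mul_add, mul_add] at this
        rwa [mul_assoc (v : ℂ), mul_assoc (v : ℂ), mul_assoc (v : ℂ)]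
      have hD := norm_second_coeff_le_of_monomial_bounds hα hw hA hE
      have hB := norm_first_coeff_le_of_monomial_bounds hα hw hA hE hD
      have hA' := norm_zeroth_coeff_le_of_monomial_bounds hα hw hA hE hD hB
      have hD := hD n
      have hB := hB n
      have hA' := hA' n
      rw [hvn, mul_assoc, ← norm_pow, ← norm_mul] at hD hB hA'
      exact ⟨hD, hB, hA'⟩
    exact ⟨⟨_, fun n z hz => (key z hz n).2.1⟩, ⟨_, fun n z hz => (key z hz n).1⟩,
      ⟨_, fun n z hz => (key z hz n).2.2⟩⟩
  · rintro ⟨hB, hD, hA⟩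
    obtain ⟨CB, hB⟩ := exists_rpow_bound_of_pow_bound (by linarith) hφm hB
    obtain ⟨CD, hD⟩ := exists_rpow_bound_of_pow_bound (by linarith) hφm hD
    obtain ⟨CA, hA⟩ := exists_rpow_bound_of_pow_bound (by linarith) hφm hA
    have hmain : ∀ f, MemBloch α f → ∀ z ∈ unitDisk,
        (1 - ‖z‖ ^ 2) ^ β * ‖deriv (deriv (wcomp u φ f)) z‖ ≤
          (CA * (1 + 1 / (α - 1)) + CB + CD * 2 ^ (α + 1)) * blochNorm α f := by
      intro f hf z hz
      have hN := blochNorm_nonneg α f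
      have hα1 : 0 < α - 1 := by linarith
      have f0 := hf.norm_le hα (hφm hz)
      have f1 := hf.norm_deriv_le (by linarith) (hφm hz)
      have f2 := hf.norm_deriv_deriv_le (by linarith) (hφm hz)
      have hv : 0 ≤ (1 - ‖z‖ ^ 2) ^ β := Real.rpow_nonneg (one_sub_norm_sq_pos hz).le _
      have hA' := hA z hz
      have hB' := hB z hz
      have hD' := hD z hz
      rw [deriv_deriv_wcomp hu hφd hφm hf.1 hz]
      set v := (1 - ‖z‖ ^ 2) ^ β
      set A := deriv (deriv u) z
      set B := 2 * deriv u z * deriv φ z + u z * deriv (deriv φ) z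
      set D := u z * deriv φ z ^ 2
      set N := blochNorm α f
      calc v * ‖A * f (φ z) + B * deriv f (φ z) + D * deriv (deriv f) (φ z)‖
          ≤ v * (‖A‖ * ‖f (φ z)‖ + ‖B‖ * ‖deriv f (φ z)‖ +
              ‖D‖ * ‖deriv (deriv f) (φ z)‖) := by
            gcongr
            refine norm_add₃_le.trans ?_
            rw [norm_mul, norm_mul, norm_mul]
        _ ≤ v * (‖A‖ * (N * (1 + 1 / (α - 1)) * (1 - ‖φ z‖) ^ (-(α - 1))) +
              ‖B‖ * (N * (1 - ‖φ z‖) ^ (-α)) +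
              ‖D‖ * (N * 2 ^ (α + 1) * (1 - ‖φ z‖) ^ (-(α + 1)))) := by gcongr
        _ = (v * ‖A‖ * (1 - ‖φ z‖) ^ (-(α - 1))) * ((1 + 1 / (α - 1)) * N) +
              (v * ‖B‖ * (1 - ‖φ z‖) ^ (-α)) * N +
              (v * ‖D‖ * (1 - ‖φ z‖) ^ (-(α + 1))) * (2 ^ (α + 1) * N) := by ring
        _ ≤ CA * ((1 + 1 / (α - 1)) * N) + CB * N + CD * (2 ^ (α + 1) * N) := by gcongr
        _ = _ := by ring
    have h0 : (0 : ℂ) ∈ unitDisk := by simp [mem_unitDisk]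
    set K := CA * (1 + 1 / (α - 1)) + CB + CD * 2 ^ (α + 1)
    set k0 := (1 + 1 / (α - 1)) * (1 - ‖φ 0‖) ^ (-(α - 1))
    set k1 := (1 - ‖φ 0‖) ^ (-α)
    have hzyg : ∀ f, MemBloch α f → zygNorm β (wcomp u φ f) ≤
        (‖u 0‖ * k0 + (‖deriv u 0‖ * k0 + ‖u 0‖ * (k1 * ‖deriv φ 0‖)) + K) * blochNorm α f := by
      intro f hf
      have f0 : ‖f (φ 0)‖ ≤ k0 * blochNorm α f :=
        (hf.norm_le hα (hφm h0)).trans (le_of_eq (by ring))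
      have f1 : ‖deriv f (φ 0)‖ ≤ k1 * blochNorm α f :=
        (hf.norm_deriv_le (by linarith) (hφm h0)).trans (le_of_eq (by ring))
      have hw := wnorm_le (hmain f hf)
      have e0 : ‖wcomp u φ f 0‖ ≤ ‖u 0‖ * (k0 * blochNorm α f) := by
        rw [wcomp, norm_mul]
        gcongr
      have e1 : ‖deriv (wcomp u φ f) 0‖ ≤ ‖deriv u 0‖ * (k0 * blochNorm α f) +
          ‖u 0‖ * (k1 * blochNorm α f * ‖deriv φ 0‖) := by
        rw [(hasDerivAt_wcomp hu hφd hφm hf.1 h0).deriv]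
        refine (norm_add_le _ _).trans ?_
        rw [norm_mul, norm_mul, norm_mul]
        gcongr
      unfold zygNorm
      linarith
    refine ⟨fun f hf => ⟨fun z hz =>
      (hasDerivAt_wcomp hu hφd hφm hf.1 hz).differentiableAt.differentiableWithinAt,
      K * blochNorm α f, ?_⟩, _, lt_of_lt_of_le zero_lt_one (le_max_left 1 _), fun f hf =>
      (hzyg f hf).trans (mul_le_mul_of_nonneg_right (le_max_right 1 _) (blochNorm_nonneg α f))⟩
    rintro _ ⟨z, hz, rfl⟩
    exact hmain f hf z hz

end
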